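/- Let U ⊆ ℝⁿ (n ≥ 2) be open, and let (g, ω) and (ḡ, ω̄) be Randers data on U such that every forward Randers geodesic of (g, ω) is a forward Randers geodesic of (ḡ, ω̄). Then for every point p ∈ U and every nonzero vector v ∈ ℝⁿ there exists a real number f such that the vector identity f·v = √(vᵀḡ(p)v)·(ḡ(p)⁻¹ (dω̄)_p v) − √(vᵀg(p)v)·(g(p)⁻¹ (dω)_p v) holds in ℝⁿ, where (dω)_p denotes the skew-symmetric matrix with entries (dω)_{ik} = (∂ω_i/∂x^k)(p) − (∂ω_k/∂x^i)(p) and similarly for (dω̄)_p. -/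

import Mathlib

open Matrix

/-- The partial derivative `∂f/∂x^k` of a scalar function on `ℝⁿ` at a point `p`. -/
noncomputable def dpart {n : ℕ} (f : (Fin n → ℝ) → ℝ) (k : Fin n) (p : Fin n → ℝ) : ℝ :=
  fderiv ℝ f p (Pi.single k 1)

/-- The differential `dω` of a 1-form `ω` (given by its components), as a
skew-symmetric-matrix-valued map: `(dω)_{ik} = ∂ω_i/∂x^k − ∂ω_k/∂x^i`. -/
noncomputable def dform {n : ℕ} (ω : (Fin n → ℝ) → (Fin n → ℝ)) (p : Fin n → ℝ) :
    Matrix (Fin n) (Fin n) ℝ :=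
  Matrix.of fun i k => dpart (fun q => ω q i) k p - dpart (fun q => ω q k) i p

/-- The 1-form `ω` is closed on `U`. -/
def IsClosedFormOn {n : ℕ} (U : Set (Fin n → ℝ)) (ω : (Fin n → ℝ) → (Fin n → ℝ)) : Prop :=
  ∀ p ∈ U, dform ω p = 0

/-- `(g, ω)` is a Randers datum on `U`: `g` is a `C²` field of symmetric positive-definite
matrices and `ω` is a `C²` field of components of a 1-form. -/
def IsRandersDatum {n : ℕ} (U : Set (Fin n → ℝ))
    (g : (Fin n → ℝ) → Matrix (Fin n) (Fin n) ℝ)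
    (ω : (Fin n → ℝ) → (Fin n → ℝ)) : Prop :=
  (∀ p ∈ U, (g p).IsSymm ∧ (g p).PosDef) ∧
  (∀ i j, ContDiffOn ℝ 2 (fun q => g q i j) U) ∧
  (∀ i, ContDiffOn ℝ 2 (fun q => ω q i) U)

/-- `x : I → U` is a forward Randers geodesic of `(g, ω)`: `I` is an open interval, `x` is a
`C²` curve in `U` with nowhere-vanishing derivative satisfying the Euler–Lagrange equation of
the Randers length functional. -/
def IsRandersGeodesic {n : ℕ} (U : Set (Fin n → ℝ))
    (g : (Fin n → ℝ) → Matrix (Fin n) (Fin n) ℝ)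
    (ω : (Fin n → ℝ) → (Fin n → ℝ))
    (I : Set ℝ) (x : ℝ → (Fin n → ℝ)) : Prop :=
  IsOpen I ∧ I.OrdConnected ∧ (∀ t ∈ I, x t ∈ U) ∧
  ContDiffOn ℝ 2 x I ∧ (∀ t ∈ I, deriv x t ≠ 0) ∧
  ∀ t ∈ I, ∀ j : Fin n,
    deriv (deriv x) t j / Real.sqrt (∑ k, ∑ m, g (x t) k m * deriv x t k * deriv x t m)
    + deriv x t j *
        deriv (fun s => 1 / Real.sqrt (∑ k, ∑ m, g (x s) k m * deriv x s k * deriv x s m)) t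
    + (1 / Real.sqrt (∑ k, ∑ m, g (x t) k m * deriv x t k * deriv x t m)) *
        ∑ i, ∑ k, ∑ p, (g (x t))⁻¹ j i * dpart (fun q => g q i p) k (x t) *
          deriv x t k * deriv x t p
    + ∑ i, ∑ k, (g (x t))⁻¹ j i *
        (dpart (fun q => ω q i) k (x t) - dpart (fun q => ω q k) i (x t)) * deriv x t k
    - (1 / (2 * Real.sqrt (∑ k, ∑ m, g (x t) k m * deriv x t k * deriv x t m))) *
        ∑ i, ∑ p, ∑ q, (g (x t))⁻¹ j i * dpart (fun r => g r p q) i (x t) *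
          deriv x t p * deriv x t q
    = 0

/-- The squared length `vᵀ g(p) v` of a tangent vector. -/
noncomputable def energy {n : ℕ} (g : (Fin n → ℝ) → Matrix (Fin n) (Fin n) ℝ)
    (p v : Fin n → ℝ) : ℝ :=
  v ⬝ᵥ (g p).mulVec v

/-- The covector `∂_k g_{iq} v^k v^q - ½ ∂_i g_{qr} v^q v^r`, the Christoffel symbols of the first
kind contracted twice with `v`. -/
noncomputable def christoffelForm {n : ℕ} (g : (Fin n → ℝ) → Matrix (Fin n) (Fin n) ℝ)
    (p v : Fin n → ℝ) : Fin n → ℝ := fun i =>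
  ∑ k, ∑ q, dpart (fun x => g x i q) k p * v k * v q
    - 1 / 2 * ∑ q, ∑ r, dpart (fun x => g x q r) i p * v q * v r

/-- The quadratic (Levi-Civita) part of the geodesic spray of a metric. -/
noncomputable def quadTerm {n : ℕ} (g : (Fin n → ℝ) → Matrix (Fin n) (Fin n) ℝ)
    (p v : Fin n → ℝ) : Fin n → ℝ :=
  (g p)⁻¹.mulVec (christoffelForm g p v)

/-- The part of the Randers geodesic spray contributed by the 1-form. -/
noncomputable def magneticTerm {n : ℕ} (g : (Fin n → ℝ) → Matrix (Fin n) (Fin n) ℝ)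
    (ω : (Fin n → ℝ) → (Fin n → ℝ)) (p v : Fin n → ℝ) : Fin n → ℝ :=
  Real.sqrt (energy g p v) • (g p)⁻¹.mulVec ((dform ω p).mulVec v)

section Algebra

variable {n : ℕ} {U : Set (Fin n → ℝ)} {g : (Fin n → ℝ) → Matrix (Fin n) (Fin n) ℝ}
  {ω : (Fin n → ℝ) → (Fin n → ℝ)}

theorem sum_sum_eq_energy (p v : Fin n → ℝ) :
    ∑ k, ∑ m, g p k m * v k * v m = energy g p v := by
  simp only [energy, dotProduct, mulVec, Finset.mul_sum]
  exact Finset.sum_congr rfl fun k _ => Finset.sum_congr rfl fun m _ => by ring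

theorem energy_neg (p v : Fin n → ℝ) : energy g p (-v) = energy g p v := by
  simp [energy, mulVec_neg]

theorem quadTerm_neg (p v : Fin n → ℝ) : quadTerm g p (-v) = quadTerm g p v := by
  rw [quadTerm, quadTerm]
  congr 1
  ext i
  simp [christoffelForm]

theorem magneticTerm_neg (p v : Fin n → ℝ) :
    magneticTerm g ω p (-v) = -magneticTerm g ω p v := by
  simp only [magneticTerm, energy_neg, mulVec_neg, smul_neg]

theorem IsRandersDatum.energy_pos (h : IsRandersDatum U g ω) {p v : Fin n → ℝ} (hp : p ∈ U)
    (hv : v ≠ 0) : 0 < energy g p v := by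
  simpa [energy] using (h.1 p hp).2.dotProduct_mulVec_pos hv

theorem IsRandersDatum.det_ne_zero (h : IsRandersDatum U g ω) {p : Fin n → ℝ} (hp : p ∈ U) :
    (g p).det ≠ 0 :=
  (h.1 p hp).2.det_pos.ne'

theorem dotProduct_dform_mulVec_self (p v : Fin n → ℝ) : v ⬝ᵥ (dform ω p).mulVec v = 0 := by
  have hT : (dform ω p)ᵀ = -dform ω p := by
    ext i k
    simp [dform]
  have h : v ⬝ᵥ (dform ω p).mulVec v = -(v ⬝ᵥ (dform ω p).mulVec v) := by
    conv_lhs => rw [dotProduct_mulVec, ← mulVec_transpose, hT, neg_mulVec, neg_dotProduct,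
      dotProduct_comm]
  linarith

theorem dotProduct_christoffelForm (p v : Fin n → ℝ) :
    v ⬝ᵥ christoffelForm g p v =
      1 / 2 * ∑ k, ∑ m, (∑ l, dpart (fun x => g x k m) l p * v l) * v k * v m := by
  have h₁ : ∑ i, v i * ∑ k, ∑ q, dpart (fun x => g x i q) k p * v k * v q =
      ∑ k, ∑ m, (∑ l, dpart (fun x => g x k m) l p * v l) * v k * v m := by
    refine Finset.sum_congr rfl fun i _ => ?_
    rw [Finset.sum_comm, Finset.mul_sum]
    refine Finset.sum_congr rfl fun q _ => ?_
    simp only [Finset.mul_sum, Finset.sum_mul]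
    exact Finset.sum_congr rfl fun l _ => by ring
  have h₂ : ∑ i, v i * ∑ q, ∑ r, dpart (fun x => g x q r) i p * v q * v r =
      ∑ k, ∑ m, (∑ l, dpart (fun x => g x k m) l p * v l) * v k * v m := by
    simp only [Finset.mul_sum, Finset.sum_mul]
    rw [Finset.sum_comm]
    refine Finset.sum_congr rfl fun q _ => ?_
    rw [Finset.sum_comm]
    exact Finset.sum_congr rfl fun r _ => Finset.sum_congr rfl fun l _ => by ring
  have h₃ : v ⬝ᵥ christoffelForm g p v =
      ∑ i, v i * ∑ k, ∑ q, dpart (fun x => g x i q) k p * v k * v q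
        - 1 / 2 * ∑ i, v i * ∑ q, ∑ r, dpart (fun x => g x q r) i p * v q * v r := by
    rw [Finset.mul_sum, ← Finset.sum_sub_distrib]
    exact Finset.sum_congr rfl fun i _ => by rw [christoffelForm]; ring
  rw [h₃, h₁, h₂]
  ring

/-- The left-hand side of the Euler–Lagrange equation in terms of the spray; `a` is the
acceleration and `d` the derivative of `1 / √(energy)`. -/
theorem eulerLagrange_eq (p v a : Fin n → ℝ) (d : ℝ) (hE : 0 < energy g p v) (j : Fin n) :
    a j / Real.sqrt (∑ k, ∑ m, g p k m * v k * v m)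
    + v j * d
    + (1 / Real.sqrt (∑ k, ∑ m, g p k m * v k * v m)) *
        ∑ i, ∑ k, ∑ q, (g p)⁻¹ j i * dpart (fun x => g x i q) k p * v k * v q
    + ∑ i, ∑ k, (g p)⁻¹ j i *
        (dpart (fun x => ω x i) k p - dpart (fun x => ω x k) i p) * v k
    - (1 / (2 * Real.sqrt (∑ k, ∑ m, g p k m * v k * v m))) *
        ∑ i, ∑ q, ∑ r, (g p)⁻¹ j i * dpart (fun x => g x q r) i p * v q * v r
    = (1 / Real.sqrt (energy g p v)) *
      (a j + (Real.sqrt (energy g p v) * d) * v j + quadTerm g p v j + magneticTerm g ω p v j) := by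
  have hs : Real.sqrt (energy g p v) ≠ 0 := (Real.sqrt_pos.mpr hE).ne'
  have hω : ∑ i, ∑ k, (g p)⁻¹ j i *
      (dpart (fun x => ω x i) k p - dpart (fun x => ω x k) i p) * v k =
      (g p)⁻¹.mulVec ((dform ω p).mulVec v) j := by
    simp only [mulVec, dotProduct, dform, Matrix.of_apply, Finset.mul_sum, mul_assoc]
  have hq : quadTerm g p v j =
      ∑ i, ∑ k, ∑ q, (g p)⁻¹ j i * dpart (fun x => g x i q) k p * v k * v q
      - 1 / 2 * ∑ i, ∑ q, ∑ r, (g p)⁻¹ j i * dpart (fun x => g x q r) i p * v q * v r := by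
    rw [Finset.mul_sum, ← Finset.sum_sub_distrib, quadTerm, mulVec, dotProduct]
    refine Finset.sum_congr rfl fun i _ => ?_
    simp only [christoffelForm, mul_sub, Finset.mul_sum]
    congr 1
    · simp only [mul_assoc]
    · exact Finset.sum_congr rfl fun q _ => Finset.sum_congr rfl fun r _ => by ring
  rw [hω, hq, sum_sum_eq_energy, magneticTerm, Pi.smul_apply, smul_eq_mul]
  field_simp
  ring

/-- Lowering the index of the geodesic spray and pairing with the velocity. -/
theorem dotProduct_mulVec_spray (h : IsRandersDatum U g ω) {p : Fin n → ℝ} (hp : p ∈ U)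
    (v : Fin n → ℝ) :
    v ⬝ᵥ (g p).mulVec (-(quadTerm g p v + magneticTerm g ω p v)) =
      -(v ⬝ᵥ christoffelForm g p v) := by
  have hu : IsUnit (g p).det := (h.det_ne_zero hp).isUnit
  simp only [quadTerm, magneticTerm, mulVec_neg, mulVec_add, mulVec_smul, mulVec_mulVec,
    Matrix.mul_nonsing_inv _ hu, one_mulVec, dotProduct_neg,
    dotProduct_add, dotProduct_smul, ← Matrix.mul_assoc, Matrix.one_mul,
    dotProduct_dform_mulVec_self, smul_zero, add_zero]

end Algebra

section Smoothness

variable {n : ℕ} {U : Set (Fin n → ℝ)} {g : (Fin n → ℝ) → Matrix (Fin n) (Fin n) ℝ}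
  {ω : (Fin n → ℝ) → (Fin n → ℝ)}

theorem fderiv_eq_sum_dpart (f : (Fin n → ℝ) → ℝ) (p v : Fin n → ℝ) :
    fderiv ℝ f p v = ∑ l, dpart f l p * v l := by
  conv_lhs => rw [pi_eq_sum_univ' v, map_sum]
  refine Finset.sum_congr rfl fun l _ => ?_
  rw [map_smul, smul_eq_mul, mul_comm]
  simp only [dpart]

theorem ContDiffAt.dpart {f : (Fin n → ℝ) → ℝ} {p : Fin n → ℝ} (hf : ContDiffAt ℝ 2 f p)
    (k : Fin n) : ContDiffAt ℝ 1 (dpart f k) p :=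
  (hf.fderiv_right (m := 1) (by norm_num)).clm_apply contDiffAt_const

theorem contDiffAt_matrix_det {E : Type*} [NormedAddCommGroup E] [NormedSpace ℝ E]
    {A : E → Matrix (Fin n) (Fin n) ℝ} {p : E} {m : WithTop ℕ∞}
    (hA : ∀ i j, ContDiffAt ℝ m (fun x => A x i j) p) : ContDiffAt ℝ m (fun x => (A x).det) p := by
  simp only [Matrix.det_apply']
  exact ContDiffAt.sum fun σ _ => contDiffAt_const.mul (contDiffAt_prod fun i _ => hA _ _)

theorem contDiffAt_matrix_inv {E : Type*} [NormedAddCommGroup E] [NormedSpace ℝ E]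
    {A : E → Matrix (Fin n) (Fin n) ℝ} {p : E} {m : WithTop ℕ∞}
    (hA : ∀ i j, ContDiffAt ℝ m (fun x => A x i j) p) (hdet : (A p).det ≠ 0) (i j : Fin n) :
    ContDiffAt ℝ m (fun x => (A x)⁻¹ i j) p := by
  simp only [Matrix.inv_def, Matrix.smul_apply, Ring.inverse_eq_inv', smul_eq_mul,
    Matrix.adjugate_apply]
  refine ((contDiffAt_matrix_det hA).inv hdet).mul (contDiffAt_matrix_det fun k l => ?_)
  by_cases hk : k = j
  · subst hk
    simpa using contDiffAt_const
  · simpa [Matrix.updateRow_ne hk] using hA k l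

theorem contDiffAt_spray (hU : IsOpen U) (h : IsRandersDatum U g ω) {p v : Fin n → ℝ}
    (hp : p ∈ U) (hv : v ≠ 0) :
    ContDiffAt ℝ 1 (fun z : (Fin n → ℝ) × (Fin n → ℝ) =>
      -(quadTerm g z.1 z.2 + magneticTerm g ω z.1 z.2)) (p, v) := by
  have lift {f : (Fin n → ℝ) → ℝ} (hf : ContDiffAt ℝ 1 f p) :
      ContDiffAt ℝ 1 (fun z : (Fin n → ℝ) × (Fin n → ℝ) => f z.1) (p, v) :=
    ContDiffAt.comp (p, v) (show ContDiffAt ℝ 1 f (p, v).1 from hf) contDiffAt_fst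
  have hg2 i j := (h.2.1 i j).contDiffAt (hU.mem_nhds hp)
  have hω2 i := (h.2.2 i).contDiffAt (hU.mem_nhds hp)
  have hg i j := lift ((hg2 i j).of_le (by norm_num))
  have hdg i j k := lift ((hg2 i j).dpart k)
  have hdω i k := lift ((hω2 i).dpart k)
  have hginv := contDiffAt_matrix_inv hg (h.det_ne_zero hp)
  have hy (i : Fin n) : ContDiffAt ℝ 1 (fun z : (Fin n → ℝ) × (Fin n → ℝ) => z.2 i) (p, v) :=
    contDiffAt_pi.mp contDiffAt_snd i
  have hE : ContDiffAt ℝ 1 (fun z : (Fin n → ℝ) × (Fin n → ℝ) => energy g z.1 z.2) (p, v) := by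
    simp only [energy, dotProduct, mulVec]
    exact ContDiffAt.sum fun i _ => (hy i).mul (ContDiffAt.sum fun j _ => (hg i j).mul (hy j))
  refine contDiffAt_pi.mpr fun j => ContDiffAt.neg (ContDiffAt.add ?_ ?_)
  · simp only [quadTerm, christoffelForm, mulVec, dotProduct]
    exact ContDiffAt.sum fun i _ => (hginv j i).mul <|
      (ContDiffAt.sum fun k _ => ContDiffAt.sum fun q _ => ((hdg i q k).mul (hy k)).mul (hy q)).sub
      (contDiffAt_const.mul <| ContDiffAt.sum fun q _ => ContDiffAt.sum fun r _ =>
        ((hdg q r i).mul (hy q)).mul (hy r))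
  · refine (hE.sqrt (h.energy_pos hp hv).ne').mul ?_
    simp only [dform, mulVec, dotProduct, Matrix.of_apply]
    exact ContDiffAt.sum fun i _ => (hginv j i).mul <| ContDiffAt.sum fun k _ =>
      ((hdω i k).sub (hdω k i)).mul (hy k)

/-- The energy is conserved along integral curves of the Randers spray. -/
theorem hasDerivAt_energy_zero (hU : IsOpen U) (h : IsRandersDatum U g ω)
    {x y : ℝ → Fin n → ℝ} {t : ℝ} (hxU : x t ∈ U) (hx : HasDerivAt x (y t) t)
    (hy : HasDerivAt y (-(quadTerm g (x t) (y t) + magneticTerm g ω (x t) (y t))) t) :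
    HasDerivAt (fun s => energy g (x s) (y s)) 0 t := by
  set a := -(quadTerm g (x t) (y t) + magneticTerm g ω (x t) (y t)) with ha
  have hg (k m : Fin n) : HasDerivAt (fun s => g (x s) k m)
      (∑ l, dpart (fun q => g q k m) l (x t) * y t l) t := by
    rw [← fderiv_eq_sum_dpart]
    exact ((((h.2.1 k m).contDiffAt (hU.mem_nhds hxU)).differentiableAt
      (by norm_num)).hasFDerivAt).comp_hasDerivAt t hx
  have hyi := hasDerivAt_pi.mp hy
  have key := HasDerivAt.fun_sum (u := Finset.univ) fun k _ => HasDerivAt.fun_sum (u := Finset.univ)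
    fun m _ => ((hg k m).mul (hyi k)).mul (hyi m)
  simp only [← sum_sum_eq_energy]
  refine key.congr_deriv ?_
  have hsymm : ∑ k, ∑ m, g (x t) k m * a k * y t m = y t ⬝ᵥ (g (x t)).mulVec a := by
    rw [Finset.sum_comm]
    simp only [dotProduct, mulVec, Finset.mul_sum]
    refine Finset.sum_congr rfl fun m _ => Finset.sum_congr rfl fun k _ => ?_
    rw [(h.1 _ hxU).1.apply]
    ring
  have hdir : ∑ k, ∑ m, g (x t) k m * y t k * a m = y t ⬝ᵥ (g (x t)).mulVec a := by
    simp only [dotProduct, mulVec, Finset.mul_sum]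
    exact Finset.sum_congr rfl fun m _ => Finset.sum_congr rfl fun k _ => by ring
  have hpair := dotProduct_mulVec_spray h hxU (y t)
  rw [← ha, dotProduct_christoffelForm] at hpair
  simp only [add_mul, Finset.sum_add_distrib, Pi.mul_apply]
  rw [hsymm, hdir, hpair]
  ring

end Smoothness

section Geodesics

variable {n : ℕ} {U : Set (Fin n → ℝ)} {g : (Fin n → ℝ) → Matrix (Fin n) (Fin n) ℝ}
  {ω : (Fin n → ℝ) → (Fin n → ℝ)}

theorem isRandersGeodesic_of_hasDerivAt (hU : IsOpen U) (h : IsRandersDatum U g ω)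
    {I : Set ℝ} (hI : IsOpen I) (hIc : I.OrdConnected) {x y : ℝ → Fin n → ℝ}
    (hxU : ∀ t ∈ I, x t ∈ U) (hy0 : ∀ t ∈ I, y t ≠ 0)
    (hx : ∀ t ∈ I, HasDerivAt x (y t) t)
    (hy : ∀ t ∈ I, HasDerivAt y (-(quadTerm g (x t) (y t) + magneticTerm g ω (x t) (y t))) t) :
    IsRandersGeodesic U g ω I x := by
  have hdx : Set.EqOn (deriv x) y I := fun t ht => (hx t ht).deriv
  have hdx' (t) (ht : t ∈ I) : deriv x =ᶠ[nhds t] y :=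
    hdx.eventuallyEq_of_mem (hI.mem_nhds ht)
  have hyC : ContDiffOn ℝ 1 y I := by
    rw [show (1 : WithTop ℕ∞) = 0 + 1 from rfl, contDiffOn_succ_iff_deriv_of_isOpen hI]
    refine ⟨fun t ht => (hy t ht).differentiableAt.differentiableWithinAt, by simp,
      contDiffOn_zero.mpr fun t ht => ContinuousAt.continuousWithinAt ?_⟩
    have hc := (contDiffAt_spray hU h (hxU t ht) (hy0 t ht)).continuousAt.comp
      (f := fun s => (x s, y s)) ((hx t ht).continuousAt.prodMk (hy t ht).continuousAt)
    refine hc.congr ?_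
    filter_upwards [hI.mem_nhds ht] with s hs using (hy s hs).deriv.symm
  refine ⟨hI, hIc, hxU, ?_, fun t ht => by rw [hdx ht]; exact hy0 t ht, fun t ht j => ?_⟩
  · rw [show (2 : WithTop ℕ∞) = 1 + 1 from one_add_one_eq_two.symm,
      contDiffOn_succ_iff_deriv_of_isOpen hI]
    exact ⟨fun t ht => (hx t ht).differentiableAt.differentiableWithinAt, by simp, hyC.congr hdx⟩
  · have hE := h.energy_pos (hxU t ht) (hy0 t ht)
    have hd : deriv (fun s => 1 / Real.sqrt
        (∑ k, ∑ m, g (x s) k m * deriv x s k * deriv x s m)) t = 0 := by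
      have h0 := ((hasDerivAt_energy_zero hU h (hxU t ht) (hx t ht) (hy t ht)).sqrt hE.ne').inv
        (Real.sqrt_pos.mpr hE).ne'
      have h1 : (fun s => 1 / Real.sqrt (∑ k, ∑ m, g (x s) k m * deriv x s k * deriv x s m))
          =ᶠ[nhds t] fun s => (Real.sqrt (energy g (x s) (y s)))⁻¹ := by
        filter_upwards [hdx' t ht] with s hs
        rw [hs, sum_sum_eq_energy, one_div]
      rw [h1.deriv_eq]
      refine Eq.trans h0.deriv ?_
      simp
    rw [hd, hdx ht, (hdx' t ht).deriv_eq, (hy t ht).deriv, eulerLagrange_eq _ _ _ _ hE]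
    simp

/-- Local existence of Randers geodesics with prescribed position and velocity. -/
theorem exists_isRandersGeodesic (hU : IsOpen U) (h : IsRandersDatum U g ω) {p v : Fin n → ℝ}
    (hp : p ∈ U) (hv : v ≠ 0) :
    ∃ (I : Set ℝ) (x : ℝ → Fin n → ℝ), (0 : ℝ) ∈ I ∧ IsRandersGeodesic U g ω I x ∧
      x 0 = p ∧ deriv x 0 = v := by
  have hF : ContDiffAt ℝ 1 (fun z : (Fin n → ℝ) × (Fin n → ℝ) =>
      (z.2, -(quadTerm g z.1 z.2 + magneticTerm g ω z.1 z.2))) (p, v) :=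
    contDiffAt_snd.prodMk (contDiffAt_spray hU h hp hv)
  obtain ⟨α, hα0, ε, hε, hα⟩ :=
    hF.exists_forall_mem_closedBall_exists_eq_forall_mem_Ioo_hasDerivAt₀ 0
  have hmem : (0 : ℝ) ∈ Set.Ioo (0 - ε) (0 + ε) := by simp [hε]
  have hO : α ⁻¹' (U ×ˢ {0}ᶜ) ∈ nhds (0 : ℝ) := by
    refine (hα 0 hmem).continuousAt.preimage_mem_nhds ?_
    rw [hα0]
    exact (hU.prod isOpen_compl_singleton).mem_nhds ⟨hp, hv⟩
  obtain ⟨δ, hδ, hball⟩ := Metric.mem_nhds_iff.mp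
    (Filter.inter_mem hO (isOpen_Ioo.mem_nhds hmem))
  have hgeo := isRandersGeodesic_of_hasDerivAt (x := fun t => (α t).1) (y := fun t => (α t).2)
    hU h Metric.isOpen_ball (convex_ball (0 : ℝ) δ).ordConnected
    (fun t ht => (hball ht).1.1) (fun t ht => (hball ht).1.2)
    (fun t ht => (hα t (hball ht).2).fst) (fun t ht => (hα t (hball ht).2).snd)
  refine ⟨_, _, Metric.mem_ball_self hδ, hgeo, by simp [hα0], ?_⟩
  rw [HasDerivAt.deriv (f := fun t => (α t).1) (hα 0 hmem).fst, hα0]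

theorem IsRandersGeodesic.exists_deriv_deriv_eq (h : IsRandersDatum U g ω) {I : Set ℝ}
    {x : ℝ → Fin n → ℝ} (hx : IsRandersGeodesic U g ω I x) {t : ℝ} (ht : t ∈ I) :
    ∃ c : ℝ, deriv (deriv x) t + c • deriv x t
      + quadTerm g (x t) (deriv x t) + magneticTerm g ω (x t) (deriv x t) = 0 := by
  obtain ⟨-, -, hxU, -, hx0, heq⟩ := hx
  have hE := h.energy_pos (hxU t ht) (hx0 t ht)
  refine ⟨Real.sqrt (energy g (x t) (deriv x t)) * deriv (fun s => 1 / Real.sqrt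
    (∑ k, ∑ m, g (x s) k m * deriv x s k * deriv x s m)) t, funext fun j => ?_⟩
  have hj := heq t ht j
  rw [eulerLagrange_eq _ _ _ _ hE] at hj
  exact (mul_eq_zero.mp hj).resolve_left (one_div_pos.mpr (Real.sqrt_pos.mpr hE)).ne'

/-- If every geodesic of one Randers datum is a geodesic of another, then their sprays differ by a
multiple of the velocity. -/
theorem exists_sprayTerms_sub_eq_smul (hU : IsOpen U)
    {gbar : (Fin n → ℝ) → Matrix (Fin n) (Fin n) ℝ} {ωbar : (Fin n → ℝ) → (Fin n → ℝ)}
    (h : IsRandersDatum U g ω) (hbar : IsRandersDatum U gbar ωbar)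
    (hproj : ∀ (I : Set ℝ) (x : ℝ → (Fin n → ℝ)),
      IsRandersGeodesic U g ω I x → IsRandersGeodesic U gbar ωbar I x)
    {p v : Fin n → ℝ} (hp : p ∈ U) (hv : v ≠ 0) :
    ∃ f : ℝ, f • v = quadTerm gbar p v + magneticTerm gbar ωbar p v
      - (quadTerm g p v + magneticTerm g ω p v) := by
  obtain ⟨I, x, h0, hx, rfl, rfl⟩ := exists_isRandersGeodesic hU h hp hv
  obtain ⟨c, hc⟩ := hx.exists_deriv_deriv_eq h h0
  obtain ⟨cbar, hcbar⟩ := (hproj I x hx).exists_deriv_deriv_eq hbar h0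
  refine ⟨c - cbar, ?_⟩
  linear_combination (norm := module) hc - hcbar

end Geodesics

/-- If two Randers data are projectively equivalent, then at every point `p` and for every
nonzero vector `v` the fundamental algebraic identity relating the two metrics and the
differentials of the two 1-forms holds. -/
theorem stmt_11 (n : ℕ) (hn : 2 ≤ n) (U : Set (Fin n → ℝ)) (hUopen : IsOpen U)
    (g gbar : (Fin n → ℝ) → Matrix (Fin n) (Fin n) ℝ)
    (ω ωbar : (Fin n → ℝ) → (Fin n → ℝ))
    (hdatum : IsRandersDatum U g ω) (hdatumbar : IsRandersDatum U gbar ωbar)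
    (hproj : ∀ (I : Set ℝ) (x : ℝ → (Fin n → ℝ)),
      IsRandersGeodesic U g ω I x → IsRandersGeodesic U gbar ωbar I x) :
    ∀ p ∈ U, ∀ v : Fin n → ℝ, v ≠ 0 → ∃ f : ℝ,
      f • v =
        Real.sqrt (v ⬝ᵥ (gbar p).mulVec v) • ((gbar p)⁻¹.mulVec ((dform ωbar p).mulVec v)) -
        Real.sqrt (v ⬝ᵥ (g p).mulVec v) • ((g p)⁻¹.mulVec ((dform ω p).mulVec v)) := by
  intro p hp v hv
  obtain ⟨f₁, h₁⟩ := exists_sprayTerms_sub_eq_smul hUopen hdatum hdatumbar hproj hp hv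
  obtain ⟨f₂, h₂⟩ := exists_sprayTerms_sub_eq_smul hUopen hdatum hdatumbar hproj hp
    (neg_ne_zero.mpr hv)
  refine ⟨(f₁ + f₂) / 2, ?_⟩
  ext j
  have e₁ := congrFun h₁ j
  have e₂ := congrFun h₂ j
  change _ = (magneticTerm gbar ωbar p v - magneticTerm g ω p v) j
  simp only [quadTerm_neg, magneticTerm_neg, Pi.sub_apply, Pi.add_apply, Pi.smul_apply,
    Pi.neg_apply, smul_eq_mul] at e₁ e₂ ⊢
  linarith
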